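/- Let n ≥ 1, let λ > 0, let L > 0, let 0 < α < 1/L, and let f : ℝ^n → ℝ be convex, continuously differentiable, and L-smooth relative to h(x) = Σ_i x_i log x_i on S. Let I ⊆ {1,...,n} be nonempty and set S_I = {x ∈ S : x_i = 0 for all i ∉ I}. Let x^0 ∈ S_I with x^0_i > 0 for all i ∈ I, and for each k ≥ 0 let x^{k+1} be the minimizer over S_I of the function z ↦ ⟨∇f(x^k), z⟩ + (1/α) D(z, x^k). Suppose supp(x^k) = I for all k ≥ 0, and let x* ∈ S_I satisfy f(x*) = min{f(x) : x ∈ S_I} and supp(x*) = I. Set F(x) = f(x) + λ‖x‖_0. Then for every K ≥ 1: F(x^K) - F(x*) ≤ D(x*, x^0) / (α K). -/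

import Mathlib

open Finset Filter Topology

noncomputable def klS (a b : ℝ) : ℝ := if a = 0 then b else a * Real.log (a / b) - a + b

noncomputable def kl {n : ℕ} (x y : Fin n → ℝ) : ℝ := ∑ i, klS (x i) (y i)

def probSimplex (n : ℕ) : Set (Fin n → ℝ) := {x | (∑ i, x i) = 1 ∧ ∀ i, 0 ≤ x i}

noncomputable def suppF {n : ℕ} (x : Fin n → ℝ) : Finset (Fin n) :=
  Finset.univ.filter (fun i => x i ≠ 0)

noncomputable def l0 {n : ℕ} (x : Fin n → ℝ) : ℕ := (suppF x).card

theorem klS_nonneg {a b : ℝ} (ha : 0 ≤ a) (hb : 0 < b) : 0 ≤ klS a b := by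
  unfold klS
  split_ifs with h
  · exact hb.le
  · have ha' : 0 < a := lt_of_le_of_ne ha (Ne.symm h)
    have hlog : Real.log (b / a) ≤ b / a - 1 := Real.log_le_sub_one_of_pos (div_pos hb ha')
    have hinv : Real.log (a / b) = -Real.log (b / a) := by
      rw [← Real.log_inv, inv_div]
    have hmul := mul_le_mul_of_nonneg_left hlog ha
    have hcancel : a * (b / a - 1) = b - a := by field_simp
    rw [hinv]
    linarith

theorem klS_self (a : ℝ) : klS a a = 0 := by
  unfold klS
  split_ifs with h
  · exact h
  · simp [div_self h]

theorem klS_le_sq_div {a b : ℝ} (ha : 0 ≤ a) (hb : 0 < b) : klS a b ≤ (a - b) ^ 2 / b := by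
  unfold klS
  split_ifs with h
  · subst h
    exact le_of_eq (by field_simp; ring)
  · have ha' : 0 < a := lt_of_le_of_ne ha (Ne.symm h)
    have hlog := mul_le_mul_of_nonneg_left (Real.log_le_sub_one_of_pos (div_pos ha' hb)) ha
    have hexpand : (a - b) ^ 2 / b = a * (a / b - 1) - a + b := by field_simp; ring
    linarith

theorem klS_three_point (a : ℝ) {b c : ℝ} (hb : 0 < b) (hc : 0 < c) :
    klS a c = klS b c + klS a b + (a - b) * Real.log (b / c) := by
  unfold klS
  rw [if_neg hb.ne']
  split_ifs with h
  · subst h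
    ring
  · rw [Real.log_div h hc.ne', Real.log_div h hb.ne', Real.log_div hb.ne' hc.ne']
    ring

section

variable {n : ℕ} {I : Finset (Fin n)}

theorem kl_self (x : Fin n → ℝ) : kl x x = 0 := by
  simp [kl, klS_self]

theorem pos_of_suppF_eq {x : Fin n → ℝ} (hx : x ∈ probSimplex n) (hxI : suppF x = I) {i : Fin n}
    (hi : i ∈ I) : 0 < x i := by
  subst hxI
  exact lt_of_le_of_ne (hx.2 i) (Ne.symm (by simpa [suppF] using hi))

theorem eq_zero_of_suppF_eq {x : Fin n → ℝ} (hxI : suppF x = I) {i : Fin n} (hi : i ∉ I) :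
    x i = 0 := by
  subst hxI
  simpa [suppF] using hi

theorem kl_nonneg {x y : Fin n → ℝ} (hx : x ∈ probSimplex n) (hxI : ∀ i ∉ I, x i = 0)
    (hy : y ∈ probSimplex n) (hyI : suppF y = I) : 0 ≤ kl x y := by
  refine Finset.sum_nonneg fun i _ => ?_
  by_cases hi : i ∈ I
  · exact klS_nonneg (hx.2 i) (pos_of_suppF_eq hy hyI hi)
  · simp [hxI i hi, eq_zero_of_suppF_eq hyI hi, klS_self]

theorem kl_le_sum_sq_div {x y : Fin n → ℝ} (hx : x ∈ probSimplex n) (hxI : ∀ i ∉ I, x i = 0)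
    (hy : y ∈ probSimplex n) (hyI : suppF y = I) : kl x y ≤ ∑ i, (x i - y i) ^ 2 / y i := by
  refine Finset.sum_le_sum fun i _ => ?_
  by_cases hi : i ∈ I
  · exact klS_le_sq_div (hx.2 i) (pos_of_suppF_eq hy hyI hi)
  · simp [hxI i hi, eq_zero_of_suppF_eq hyI hi, klS_self]

/-- The three-point identity of the Bregman divergence `kl`. -/
theorem kl_three_point {x y z : Fin n → ℝ} (hz : ∀ i ∉ I, z i = 0)
    (hy : y ∈ probSimplex n) (hyI : suppF y = I) (hx : x ∈ probSimplex n) (hxI : suppF x = I) :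
    kl z x = kl y x + kl z y + ∑ i, (z i - y i) * Real.log (y i / x i) := by
  unfold kl
  rw [← Finset.sum_add_distrib, ← Finset.sum_add_distrib]
  refine Finset.sum_congr rfl fun i _ => ?_
  by_cases hi : i ∈ I
  · exact klS_three_point _ (pos_of_suppF_eq hy hyI hi) (pos_of_suppF_eq hx hxI hi)
  · simp [hz i hi, eq_zero_of_suppF_eq hyI hi, eq_zero_of_suppF_eq hxI hi, klS_self]

theorem nonneg_of_forall_add_mul_sq_nonneg {a c : ℝ}
    (h : ∀ t : ℝ, 0 < t → t ≤ 1 → 0 ≤ t * a + t ^ 2 * c) : 0 ≤ a := by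
  have hlim : Tendsto (fun t : ℝ => a + t * c) (𝓝[>] 0) (𝓝 a) := by
    have hcont : Continuous fun t : ℝ => a + t * c := by fun_prop
    simpa using (hcont.tendsto 0).mono_left nhdsWithin_le_nhds
  refine ge_of_tendsto hlim ?_
  filter_upwards [Ioc_mem_nhdsGT (zero_lt_one (α := ℝ))] with t ht
  have := h t ht.1 ht.2
  refine nonneg_of_mul_nonneg_right (a := t) ?_ ht.1
  linarith

/-- The mirror-descent step satisfies the three-point inequality. -/
theorem three_point_inequality {β : ℝ} (hβ : 0 ≤ β) (g : (Fin n → ℝ) →L[ℝ] ℝ) {x y : Fin n → ℝ}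
    (hx : x ∈ probSimplex n) (hxI : suppF x = I) (hy : y ∈ probSimplex n) (hyI : suppF y = I)
    (hmin : ∀ z ∈ probSimplex n, (∀ i ∉ I, z i = 0) → g y + β * kl y x ≤ g z + β * kl z x)
    {z : Fin n → ℝ} (hz : z ∈ probSimplex n) (hzI : ∀ i ∉ I, z i = 0) :
    g y + β * kl y x + β * kl z y ≤ g z + β * kl z x := by
  suffices h : 0 ≤ g (z - y) + β * ∑ i, (z i - y i) * Real.log (y i / x i) by
    rw [kl_three_point hzI hy hyI hx hxI]
    rw [map_sub] at h
    linarith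
  refine nonneg_of_forall_add_mul_sq_nonneg (c := β * ∑ i, (z i - y i) ^ 2 / y i)
    fun t ht ht1 => ?_
  set w : Fin n → ℝ := y + t • (z - y) with hw
  have hwi : ∀ i, w i - y i = t * (z i - y i) := fun i => by simp [hw]
  have hwS : w ∈ probSimplex n := by
    refine ⟨?_, fun i => ?_⟩
    · have hsum : ∑ i, w i = ∑ i, y i + t * (∑ i, z i - ∑ i, y i) := by
        rw [← Finset.sum_sub_distrib, Finset.mul_sum, ← Finset.sum_add_distrib]
        exact Finset.sum_congr rfl fun i _ => by linarith [hwi i]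
      rw [hsum, hz.1, hy.1]
      ring
    · have hyi := mul_nonneg (sub_nonneg.2 ht1) (hy.2 i)
      have hzi := mul_nonneg ht.le (hz.2 i)
      linarith [hwi i]
  have hwI : ∀ i ∉ I, w i = 0 := fun i hi => by
    simp [hw, hzI i hi, eq_zero_of_suppF_eq hyI hi]
  have hopt := hmin w hwS hwI
  rw [kl_three_point hwI hy hyI hx hxI] at hopt
  have hquad := mul_le_mul_of_nonneg_left (kl_le_sum_sq_div hwS hwI hy hyI) hβ
  have hlin : ∑ i, (w i - y i) * Real.log (y i / x i) =
      t * ∑ i, (z i - y i) * Real.log (y i / x i) := by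
    rw [Finset.mul_sum]
    exact Finset.sum_congr rfl fun i _ => by rw [hwi i, mul_assoc]
  have hsq : ∑ i, (w i - y i) ^ 2 / y i = t ^ 2 * ∑ i, (z i - y i) ^ 2 / y i := by
    rw [Finset.mul_sum]
    exact Finset.sum_congr rfl fun i _ => by rw [hwi i, mul_pow, mul_div_assoc]
  have hgw : g w = g y + t * g (z - y) := by simp [hw]
  rw [hlin, hgw] at hopt
  rw [hsq] at hquad
  linarith

end

theorem ConvexOn.add_fderiv_sub_le {E : Type*} [NormedAddCommGroup E] [NormedSpace ℝ E]
    {f : E → ℝ} (hconv : ConvexOn ℝ Set.univ f) {x : E} (hf : DifferentiableAt ℝ f x) (z : E) :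
    f x + fderiv ℝ f x (z - x) ≤ f z := by
  have hline : ConvexOn ℝ Set.univ (f ∘ AffineMap.lineMap (k := ℝ) x z) := by
    simpa using hconv.comp_affineMap (AffineMap.lineMap (k := ℝ) x z)
  have hderiv : HasDerivAt (f ∘ AffineMap.lineMap (k := ℝ) x z) (fderiv ℝ f x (z - x)) 0 := by
    have hfx : HasFDerivAt f (fderiv ℝ f x) (AffineMap.lineMap (k := ℝ) x z (0 : ℝ)) := by
      simpa using hf.hasFDerivAt
    exact hfx.comp_hasDerivAt 0 AffineMap.hasDerivAt_lineMap
  have hslope := hline.le_slope_of_hasDerivAt (Set.mem_univ 0) (Set.mem_univ 1) zero_lt_one hderiv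
  simp only [slope_def_field, Function.comp_apply, AffineMap.lineMap_apply_zero,
    AffineMap.lineMap_apply_one, sub_zero, div_one] at hslope
  linarith

/-- O(1/K) convergence rate of the objective values once the support is fixed. -/
theorem stmt_11 (n : ℕ) (hn : 1 ≤ n) (lam L α : ℝ) (hlam : 0 < lam) (hL : 0 < L)
    (hα0 : 0 < α) (hαL : α < 1 / L)
    (f : (Fin n → ℝ) → ℝ) (hconv : ConvexOn ℝ Set.univ f) (hf : ContDiff ℝ 1 f)
    (hsmooth : ∀ z ∈ probSimplex n, ∀ w ∈ probSimplex n, suppF z ⊆ suppF w →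
      f z ≤ f w + fderiv ℝ f w (z - w) + L * kl z w)
    (I : Finset (Fin n)) (hI : I.Nonempty)
    (X : ℕ → Fin n → ℝ)
    (hX0 : X 0 ∈ probSimplex n) (hX0I : ∀ i ∉ I, X 0 i = 0) (hX0pos : ∀ i ∈ I, 0 < X 0 i)
    (hXmem : ∀ k, X (k + 1) ∈ probSimplex n) (hXI : ∀ k, ∀ i ∉ I, X (k + 1) i = 0)
    (hXmin : ∀ k, ∀ z ∈ probSimplex n, (∀ i ∉ I, z i = 0) →
      fderiv ℝ f (X k) (X (k + 1)) + (1 / α) * kl (X (k + 1)) (X k) ≤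
      fderiv ℝ f (X k) z + (1 / α) * kl z (X k))
    (hXsupp : ∀ k, suppF (X k) = I)
    (xstar : Fin n → ℝ) (hxs : xstar ∈ probSimplex n) (hxsI : ∀ i ∉ I, xstar i = 0)
    (hxsmin : ∀ z ∈ probSimplex n, (∀ i ∉ I, z i = 0) → f xstar ≤ f z)
    (hxssupp : suppF xstar = I) :
    ∀ K : ℕ, 1 ≤ K →
      (f (X K) + lam * (l0 (X K) : ℝ)) - (f xstar + lam * (l0 xstar : ℝ)) ≤
        kl xstar (X 0) / (α * K) := by
  have hβ : 0 ≤ 1 / α := by positivity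
  have hLα : L ≤ 1 / α := by
    rw [le_div_iff₀ hα0]
    rw [lt_div_iff₀ hL] at hαL
    linarith
  have hXS : ∀ k, X k ∈ probSimplex n := fun k => by
    cases k with
    | zero => exact hX0
    | succ k => exact hXmem k
  have hstep : ∀ k, ∀ z ∈ probSimplex n, (∀ i ∉ I, z i = 0) →
      f (X (k + 1)) + 1 / α * kl z (X (k + 1)) ≤ f z + 1 / α * kl z (X k) := by
    intro k z hz hzI
    have hthree := three_point_inequality hβ (fderiv ℝ f (X k)) (hXS k) (hXsupp k) (hXS (k + 1))
      (hXsupp (k + 1)) (hXmin k) hz hzI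
    have hdesc := hsmooth (X (k + 1)) (hXS (k + 1)) (X k) (hXS k) (by rw [hXsupp, hXsupp])
    have hgrad := hconv.add_fderiv_sub_le (hf.differentiable one_ne_zero (X k)) z
    have hscale := mul_le_mul_of_nonneg_right hLα
      (kl_nonneg (hXS (k + 1)) (hXI k) (hXS k) (hXsupp k))
    rw [map_sub] at hdesc hgrad
    linarith
  have hmono : ∀ k, f (X (k + 1)) ≤ f (X k) := by
    intro k
    have hXkI : ∀ i ∉ I, X k i = 0 := fun i hi => eq_zero_of_suppF_eq (hXsupp k) hi
    have hk := hstep k (X k) (hXS k) hXkI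
    have hnonneg := mul_nonneg hβ (kl_nonneg (hXS k) hXkI (hXS (k + 1)) (hXsupp (k + 1)))
    rw [kl_self, mul_zero] at hk
    linarith
  have htele : ∀ K : ℕ, K * (f (X K) - f xstar) + 1 / α * kl xstar (X K) ≤
      1 / α * kl xstar (X 0) := by
    intro K
    induction K with
    | zero => simp
    | succ K ih =>
      have hk := hstep K xstar hxs hxsI
      have hdecr := mul_le_mul_of_nonneg_left (hmono K) (Nat.cast_nonneg (α := ℝ) K)
      push_cast
      linarith
  intro K hK
  have hKpos : (0 : ℝ) < K := by exact_mod_cast hK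
  have hl0 : l0 (X K) = l0 xstar := by rw [l0, l0, hXsupp, hxssupp]
  have hnonneg := mul_nonneg hβ (kl_nonneg hxs hxsI (hXS K) (hXsupp K))
  have hbound : K * (f (X K) - f xstar) ≤ 1 / α * kl xstar (X 0) := by linarith [htele K]
  rw [hl0, add_sub_add_right_eq_sub, le_div_iff₀ (by positivity)]
  rw [one_div_mul_eq_div, le_div_iff₀ hα0] at hbound
  linarith
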